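/- Let all preferences in P be substitutable and satisfy the law of aggregate demand. Then a matching μ is stable under P if and only if there exist k ≥ 0 and a finite sequence of matchings μ_0, μ_1, …, μ_k with μ_0 = μ_F (the firm-optimal stable matching), μ_k = μ, each μ_i ∈ S(P), and such that for each i < k the matching μ_{i+1} is a cyclic matching under the reduced preference profile P^{μ_i} (the reduced profile with respect to μ_i and the worker-optimal stable matching μ_W). In particular, the set consisting of μ_F together with all matchings reachable from μ_F by finitely many cyclic-matching steps equals the full set of stable matchings S(P). -/

import Mathlib

open Finset

noncomputable section

open scoped Classical

/-- `C` is a choice function: `C S ⊆ S` for every `S`. -/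
def IsChoiceFun {α : Type*} (C : Finset α → Finset α) : Prop := ∀ S, C S ⊆ S

/-- Substitutability of a choice function: if `b` is chosen from `S`, then `b` is chosen
from `S' ∪ {b}` for every `S' ⊆ S`. -/
def Substitutable {α : Type*} [DecidableEq α] (C : Finset α → Finset α) : Prop :=
  ∀ (S S' : Finset α) (b : α), S' ⊆ S → b ∈ C S → b ∈ C (insert b S')

/-- The law of aggregate demand for a choice function. -/
def LAD {α : Type*} (C : Finset α → Finset α) : Prop :=
  ∀ S' S : Finset α, S' ⊆ S → (C S').card ≤ (C S).card

/-- The most `u`-preferred subset of `S` among the members of the family `A` of acceptable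
sets (the empty set is always available as a fallback). -/
def bestIn {α : Type*} (u : Finset α → ℕ) (A : Set (Finset α)) (S : Finset α) : Finset α := by
  classical
  have h : ∃ T ∈ (S.powerset).filter (fun T => T ∈ A ∨ T = ∅),
      ∀ T' ∈ (S.powerset).filter (fun T => T ∈ A ∨ T = ∅), u T' ≤ u T :=
    Finset.exists_max_image _ u ⟨∅, by simp⟩
  exact h.choose

/-- A many-to-many matching market: each firm `f` has a strict preference over subsets
of workers, represented by an injective utility `uF f`, and symmetrically for workers. -/
structure Market (F W : Type*) where
  uF : F → Finset W → ℕ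
  uW : W → Finset F → ℕ
  injF : ∀ f, Function.Injective (uF f)
  injW : ∀ w, Function.Injective (uW w)

/-- A many-to-many matching. -/
structure Matching (F W : Type*) where
  fm : F → Finset W
  wm : W → Finset F
  consistent : ∀ f w, w ∈ fm f ↔ f ∈ wm w

namespace Market

variable {F W : Type*} [DecidableEq F] [DecidableEq W]

/-- The choice set of firm `f` under the original preference: the most preferred
subset among the acceptable subsets (those strictly preferred to `∅`). -/
def Cf (M : Market F W) (f : F) : Finset W → Finset W :=
  bestIn (M.uF f) {T | M.uF f ∅ < M.uF f T}

/-- The choice set of worker `w` under the original preference. -/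
def Cw (M : Market F W) (w : W) : Finset F → Finset F :=
  bestIn (M.uW w) {T | M.uW w ∅ < M.uW w T}

/-- Individual rationality under the original profile. -/
def IR (M : Market F W) (μ : Matching F W) : Prop :=
  (∀ f, M.Cf f (μ.fm f) = μ.fm f) ∧ (∀ w, M.Cw w (μ.wm w) = μ.wm w)

/-- `(f,w)` blocks `μ` under the original profile. -/
def Blocks (M : Market F W) (μ : Matching F W) (f : F) (w : W) : Prop :=
  w ∉ μ.fm f ∧ w ∈ M.Cf f (insert w (μ.fm f)) ∧ f ∈ M.Cw w (insert f (μ.wm w))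

/-- Stability under the original profile. -/
def Stable (M : Market F W) (μ : Matching F W) : Prop :=
  M.IR μ ∧ ∀ f w, ¬ M.Blocks μ f w

/-- Blair's partial order for firm `f`: `S ⪰_f S'` iff `C_f (S ∪ S') = S`. -/
def blairF (M : Market F W) (f : F) (S S' : Finset W) : Prop := M.Cf f (S ∪ S') = S

/-- Blair's partial order for worker `w`. -/
def blairW (M : Market F W) (w : W) (S S' : Finset F) : Prop := M.Cw w (S ∪ S') = S

/-- The unanimous Blair order for the firms' side: `μ ⪰_F μ'`. -/
def geF (M : Market F W) (μ μ' : Matching F W) : Prop := ∀ f, M.blairF f (μ.fm f) (μ'.fm f)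

/-- The unanimous Blair order for the workers' side: `μ ⪰_W μ'`. -/
def geW (M : Market F W) (μ μ' : Matching F W) : Prop := ∀ w, M.blairW w (μ.wm w) (μ'.wm w)

/-- Strict unanimous Blair order for the firms' side: `μ ≻_F μ'`. -/
def gtF (M : Market F W) (μ μ' : Matching F W) : Prop := M.geF μ μ' ∧ μ ≠ μ'

/-- Workers deleted from `f`'s list in Step 1(a) of the reduction procedure:
those belonging to some `W' ≻_f μ(f)` but not to `μ(f)`. -/
def D1 (M : Market F W) (μ : Matching F W) (f : F) : Set W :=
  {x | ∃ W' : Finset W, (M.Cf f (W' ∪ μ.fm f) = W' ∧ W' ≠ μ.fm f) ∧ x ∈ W' ∧ x ∉ μ.fm f}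

/-- Workers deleted from `f`'s list in Step 2(a): those belonging to some `W'` with
`μ̃(f) ≻_f W'` but not to `μ̃(f)`. -/
def D2 (M : Market F W) (μt : Matching F W) (f : F) : Set W :=
  {x | ∃ W' : Finset W, (M.Cf f (μt.fm f ∪ W') = μt.fm f ∧ μt.fm f ≠ W') ∧ x ∈ W' ∧ x ∉ μt.fm f}

/-- Firms deleted from `w`'s list in Step 1(b). -/
def E1 (M : Market F W) (μt : Matching F W) (w : W) : Set F :=
  {x | ∃ F' : Finset F, (M.Cw w (F' ∪ μt.wm w) = F' ∧ F' ≠ μt.wm w) ∧ x ∈ F' ∧ x ∉ μt.wm w}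

/-- Firms deleted from `w`'s list in Step 2(b). -/
def E2 (M : Market F W) (μ : Matching F W) (w : W) : Set F :=
  {x | ∃ F' : Finset F, (M.Cw w (μ.wm w ∪ F') = μ.wm w ∧ μ.wm w ≠ F') ∧ x ∈ F' ∧ x ∉ μ.wm w}

/-- Workers deleted from `f`'s list in Step 3: those workers `w` for which `{f}` is no
longer on `w`'s list after Steps 1 and 2 (either `{f}` was never acceptable to `w`, or
`f` was deleted from `w`'s list in Step 1(b) or 2(b)). -/
def D3 (M : Market F W) (μ μt : Matching F W) (f : F) : Set W :=
  {w | ¬ (M.uW w ∅ < M.uW w {f}) ∨ f ∈ M.E1 μt w ∪ M.E2 μ w}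

/-- Firms deleted from `w`'s list in Step 3. -/
def E3 (M : Market F W) (μ μt : Matching F W) (w : W) : Set F :=
  {f | ¬ (M.uF f ∅ < M.uF f {w}) ∨ w ∈ M.D1 μ f ∪ M.D2 μt f}

/-- All workers deleted from `f`'s list in the reduction procedure. -/
def Dall (M : Market F W) (μ μt : Matching F W) (f : F) : Set W :=
  M.D1 μ f ∪ M.D2 μt f ∪ M.D3 μ μt f

/-- All firms deleted from `w`'s list in the reduction procedure. -/
def Eall (M : Market F W) (μ μt : Matching F W) (w : W) : Set F :=
  M.E1 μt w ∪ M.E2 μ w ∪ M.E3 μ μt w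

/-- The family of sets surviving in `f`'s list under the reduced profile `P^{μ,μ̃}`:
originally acceptable sets containing no deleted worker. -/
def RAf (M : Market F W) (μ μt : Matching F W) (f : F) : Set (Finset W) :=
  {T | M.uF f ∅ < M.uF f T ∧ ∀ x ∈ T, x ∉ M.Dall μ μt f}

/-- The family of sets surviving in `w`'s list under the reduced profile `P^{μ,μ̃}`. -/
def RAw (M : Market F W) (μ μt : Matching F W) (w : W) : Set (Finset F) :=
  {T | M.uW w ∅ < M.uW w T ∧ ∀ x ∈ T, x ∉ M.Eall μ μt w}

/-- The choice set `C^{μ,μ̃}_f` of firm `f` under the reduced profile. -/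
def Cfred (M : Market F W) (μ μt : Matching F W) (f : F) : Finset W → Finset W :=
  bestIn (M.uF f) (M.RAf μ μt f)

/-- The choice set `C^{μ,μ̃}_w` of worker `w` under the reduced profile. -/
def Cwred (M : Market F W) (μ μt : Matching F W) (w : W) : Finset F → Finset F :=
  bestIn (M.uW w) (M.RAw μ μt w)

/-- Individual rationality under the reduced profile `P^{μ,μ̃}`. -/
def IRred (M : Market F W) (μ μt ν : Matching F W) : Prop :=
  (∀ f, M.Cfred μ μt f (ν.fm f) = ν.fm f) ∧ (∀ w, M.Cwred μ μt w (ν.wm w) = ν.wm w)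

/-- Blocking under the reduced profile `P^{μ,μ̃}`. -/
def Blocksred (M : Market F W) (μ μt ν : Matching F W) (f : F) (w : W) : Prop :=
  w ∉ ν.fm f ∧ w ∈ M.Cfred μ μt f (insert w (ν.fm f)) ∧
    f ∈ M.Cwred μ μt w (insert f (ν.wm w))

/-- Stability under the reduced profile `P^{μ,μ̃}`. -/
def Stablered (M : Market F W) (μ μt ν : Matching F W) : Prop :=
  M.IRred μ μt ν ∧ ∀ f w, ¬ M.Blocksred μ μt ν f w

/-- The unanimous Blair order on the firms' side computed with the reduced choice sets. -/
def geFred (M : Market F W) (μ μt ν ν' : Matching F W) : Prop :=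
  ∀ f, M.Cfred μ μt f (ν.fm f ∪ ν'.fm f) = ν.fm f

/-- The unanimous Blair order on the workers' side computed with the reduced choice sets. -/
def geWred (M : Market F W) (μ μt ν ν' : Matching F W) : Prop :=
  ∀ w, M.Cwred μ μt w (ν.wm w ∪ ν'.wm w) = ν.wm w

/-- All preferences in the market are substitutable. -/
def SubstAll (M : Market F W) : Prop :=
  (∀ f, Substitutable (M.Cf f)) ∧ (∀ w, Substitutable (M.Cw w))

/-- All preferences in the market satisfy the law of aggregate demand. -/
def LADAll (M : Market F W) : Prop :=
  (∀ f, LAD (M.Cf f)) ∧ (∀ w, LAD (M.Cw w))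

/-- A cycle for the reduced profile `P^{μ,μ̃}`: an `r`-periodic sequence of worker-firm
pairs `(w_i, f_i)` (indexed cyclically) such that (i) `w_i ∈ μ(f_i) \ μ̃(f_i)`;
(ii) `C^{μ,μ̃}_{f_i}(W \ {w_i}) = (μ(f_i) \ {w_i}) ∪ {w_{i+1}}`; and (iii)
`C^{μ,μ̃}_{w_{i+1}}(μ(w_{i+1}) ∪ {f_i}) = (μ(w_{i+1}) \ {f_{i+1}}) ∪ {f_i}`. -/
def IsCycle [Fintype W] (M : Market F W) (μ μt : Matching F W) (r : ℕ)
    (w : ℕ → W) (f : ℕ → F) : Prop :=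
  0 < r ∧ (∀ i, w (i + r) = w i) ∧ (∀ i, f (i + r) = f i) ∧
  ∀ i, (w i ∈ μ.fm (f i) ∧ w i ∉ μt.fm (f i)) ∧
    M.Cfred μ μt (f i) (Finset.univ \ {w i}) = insert (w (i + 1)) (μ.fm (f i) \ {w i}) ∧
    M.Cwred μ μt (w (i + 1)) (μ.wm (w (i + 1)) ∪ {f i}) =
      insert (f i) (μ.wm (w (i + 1)) \ {f (i + 1)})

/-- The firm-side assignment of the cyclic matching `μ_σ` obtained from the cycle
`σ = (w, f)` of length `r`. -/
def cyclicFm (μ : Matching F W) (r : ℕ) (w : ℕ → W) (f : ℕ → F) (g : F) : Finset W :=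
  if ∃ i ∈ Finset.range r, f i = g then
    (μ.fm g \ ((Finset.range r).filter (fun i => f i = g)).image w) ∪
      ((Finset.range r).filter (fun i => f i = g)).image (fun i => w (i + 1))
  else μ.fm g

/-- `ν` is a cyclic matching under the reduced profile `P^{μ,μ̃}`: `ν = μ_σ` for some
cycle `σ` for `P^{μ,μ̃}` (the worker side of `ν` is determined by consistency). -/
def IsCyclicMatching [Fintype W] (M : Market F W) (μ μt ν : Matching F W) : Prop :=
  ∃ (r : ℕ) (w : ℕ → W) (f : ℕ → F),
    M.IsCycle μ μt r w f ∧ ∀ g, ν.fm g = cyclicFm μ r w f g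

end Market

/-- Basic package of facts about a choice function. -/
structure GoodC {α : Type*} [DecidableEq α] (C : Finset α → Finset α) : Prop where
  sub : ∀ S, C S ⊆ S
  cons : ∀ S T, C S ⊆ T → T ⊆ S → C T = C S
  subst : Substitutable C
  lad : LAD C

theorem bestIn_spec {α : Type*} (u : Finset α → ℕ) (A : Set (Finset α)) (S : Finset α) :
    bestIn u A S ⊆ S ∧ (bestIn u A S ∈ A ∨ bestIn u A S = ∅) ∧
      ∀ T, T ⊆ S → (T ∈ A ∨ T = ∅) → u T ≤ u (bestIn u A S) := by
  classical
  have h : ∃ T ∈ (S.powerset).filter (fun T => T ∈ A ∨ T = ∅),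
      ∀ T' ∈ (S.powerset).filter (fun T => T ∈ A ∨ T = ∅), u T' ≤ u T :=
    Finset.exists_max_image _ u ⟨∅, by simp⟩
  have h2 := h.choose_spec
  have e : bestIn u A S = h.choose := by
    unfold bestIn
    congr!
  rw [e]
  obtain ⟨h3, h4⟩ := h2
  rw [Finset.mem_filter, Finset.mem_powerset] at h3
  refine ⟨h3.1, h3.2, fun T hT hA => h4 T ?_⟩
  rw [Finset.mem_filter, Finset.mem_powerset]
  exact ⟨hT, hA⟩

theorem bestIn_unique {α : Type*} (u : Finset α → ℕ) (hu : Function.Injective u)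
    (A : Set (Finset α)) (S T : Finset α) (h1 : T ⊆ S) (h2 : T ∈ A ∨ T = ∅)
    (h3 : ∀ T', T' ⊆ S → (T' ∈ A ∨ T' = ∅) → u T' ≤ u T) : bestIn u A S = T := by
  obtain ⟨a, b, c⟩ := bestIn_spec u A S
  exact hu (le_antisymm (h3 _ a b) (c _ h1 h2))

theorem goodC_bestIn {α : Type*} [DecidableEq α] (u : Finset α → ℕ) (hu : Function.Injective u)
    (A : Set (Finset α)) (h1 : Substitutable (bestIn u A)) (h2 : LAD (bestIn u A)) :
    GoodC (bestIn u A) := by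
  refine ⟨fun S => (bestIn_spec u A S).1, fun S T hS hT => ?_, h1, h2⟩
  obtain ⟨a, b, c⟩ := bestIn_spec u A S
  exact bestIn_unique u hu A T _ hS b fun T' hT' h => c _ (hT'.trans hT) h

theorem bestIn_filter {α : Type*} (u : Finset α → ℕ) (hu : Function.Injective u)
    (A B : Set (Finset α)) (p : α → Prop) (hB : ∀ T, T ∈ B ↔ T ∈ A ∧ ∀ x ∈ T, p x)
    (S : Finset α) : bestIn u B S = bestIn u A (S.filter p) := by
  obtain ⟨a, b, c⟩ := bestIn_spec u A (S.filter p)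
  refine bestIn_unique u hu B S _ (a.trans (Finset.filter_subset _ _)) ?_ ?_
  · rcases b with b | b
    · exact Or.inl ((hB _).2 ⟨b, fun x hx => (Finset.mem_filter.1 (a hx)).2⟩)
    · exact Or.inr b
  · intro T hT h
    rcases h with h | h
    · rw [hB] at h
      exact c T (fun x hx => Finset.mem_filter.2 ⟨hT hx, h.2 x hx⟩) (Or.inl h.1)
    · subst h
      exact c ∅ (Finset.empty_subset _) (Or.inr rfl)

namespace GoodC

variable {α : Type*} [DecidableEq α] {C : Finset α → Finset α}

theorem mono (h : GoodC C) {S T : Finset α} {x : α} (hx : x ∈ C S) (hT : T ⊆ S) (hxT : x ∈ T) :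
    x ∈ C T := by
  have := h.subst S T x hT hx
  rwa [Finset.insert_eq_of_mem hxT] at this

theorem eq_of_rej (h : GoodC C) {S T : Finset α} (hTS : T ⊆ S) (hT : C T = T)
    (hr : ∀ x ∈ S, x ∉ T → x ∉ C (insert x T)) : C S = T := by
  have : C S ⊆ T := by
    intro x hx
    by_contra hxT
    exact hr x (h.sub _ hx) hxT (h.subst S T x hTS hx)
  rw [← h.cons S T this hTS, hT]

theorem idem (h : GoodC C) (S : Finset α) : C (C S) = C S :=
  h.cons S _ subset_rfl (h.sub S)

theorem pi (h : GoodC C) {S : Finset α} (x : α) : C (insert x (C S)) = C (insert x S) := by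
  apply h.cons
  · intro y hy
    by_cases hyx : y = x
    · simp [hyx]
    · have hyS : y ∈ S := by
        have := h.sub _ hy
        simpa [hyx] using this
      exact Finset.mem_insert_of_mem (h.mono hy (Finset.subset_insert _ _) hyS)
  · exact Finset.insert_subset_insert _ (h.sub S)

end GoodC

namespace Market

variable {F W : Type*} [DecidableEq F] [DecidableEq W]

/-- Pairs surviving the reduction. -/
def Surv (M : Market F W) (μ μt : Matching F W) (f : F) (w : W) : Prop :=
  w ∈ M.Cf f (insert w (μt.fm f)) ∧ f ∈ M.Cw w (insert f (μ.wm w))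

theorem goodF (M : Market F W) (hsub : M.SubstAll) (hlad : M.LADAll) (f : F) :
    GoodC (M.Cf f) :=
  goodC_bestIn _ (M.injF f) _ (hsub.1 f) (hlad.1 f)

theorem goodW (M : Market F W) (hsub : M.SubstAll) (hlad : M.LADAll) (w : W) :
    GoodC (M.Cw w) :=
  goodC_bestIn _ (M.injW w) _ (hsub.2 w) (hlad.2 w)

theorem accF {M : Market F W} (hsub : M.SubstAll) {f : F} {w : W} {S : Finset W}
    (h : w ∈ M.Cf f S) : M.uF f ∅ < M.uF f {w} := by
  have h1 := hsub.1 f S ∅ w (Finset.empty_subset _) h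
  obtain ⟨a, b, -⟩ := bestIn_spec (M.uF f) {T | M.uF f ∅ < M.uF f T} (insert w ∅)
  change M.Cf f (insert w ∅) ⊆ _ at a
  change (M.Cf f (insert w ∅) ∈ _ ∨ M.Cf f (insert w ∅) = ∅) at b
  have e : M.Cf f (insert w ∅) = {w} :=
    Finset.Subset.antisymm (by simpa using a) (by simpa using h1)
  rw [e] at b
  simpa using b

theorem accW {M : Market F W} (hsub : M.SubstAll) {f : F} {w : W} {S : Finset F}
    (h : f ∈ M.Cw w S) : M.uW w ∅ < M.uW w {f} := by
  have h1 := hsub.2 w S ∅ f (Finset.empty_subset _) h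
  obtain ⟨a, b, -⟩ := bestIn_spec (M.uW w) {T | M.uW w ∅ < M.uW w T} (insert f ∅)
  change M.Cw w (insert f ∅) ⊆ _ at a
  change (M.Cw w (insert f ∅) ∈ _ ∨ M.Cw w (insert f ∅) = ∅) at b
  have e : M.Cw w (insert f ∅) = {f} :=
    Finset.Subset.antisymm (by simpa using a) (by simpa using h1)
  rw [e] at b
  simpa using b

/-- Abstract form of the Step 1 deletions. -/
theorem del1 {α : Type*} [DecidableEq α] {C : Finset α → Finset α} (h : GoodC C) (S : Finset α)
    (x : α) : (∃ W' : Finset α, (C (W' ∪ S) = W' ∧ W' ≠ S) ∧ x ∈ W' ∧ x ∉ S) ↔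
      x ∉ S ∧ x ∈ C (insert x S) := by
  constructor
  · rintro ⟨W', ⟨h1, -⟩, h2, h3⟩
    exact ⟨h3, h.subst (W' ∪ S) S x Finset.subset_union_right (by rwa [h1])⟩
  · rintro ⟨h1, h2⟩
    refine ⟨C (insert x S), ⟨?_, ?_⟩, h2, h1⟩
    · apply h.cons
      · exact Finset.subset_union_left
      · exact Finset.union_subset (h.sub _) (Finset.subset_insert _ _)
    · intro e
      rw [e] at h2
      exact h1 h2

/-- Abstract form of the Step 2 deletions. -/
theorem del2 {α : Type*} [DecidableEq α] {C : Finset α → Finset α} (h : GoodC C) (S : Finset α)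
    (hS : C S = S)
    (x : α) : (∃ W' : Finset α, (C (S ∪ W') = S ∧ S ≠ W') ∧ x ∈ W' ∧ x ∉ S) ↔
      x ∉ C (insert x S) := by
  constructor
  · rintro ⟨W', ⟨h1, -⟩, h2, h3⟩ h4
    have : C (insert x S) = C (S ∪ W') := by
      apply h.cons
      · rw [h1]
        exact Finset.subset_insert _ _
      · intro y hy
        rw [Finset.mem_insert] at hy
        rcases hy with rfl | hy <;> simp [*]
    rw [this, h1] at h4
    exact h3 h4
  · intro h1
    have hx : x ∉ S := fun hx => h1 (by rwa [Finset.insert_eq_of_mem hx, hS])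
    refine ⟨{x}, ⟨?_, ?_⟩, by simp, hx⟩
    · apply h.eq_of_rej Finset.subset_union_left hS
      intro y hy hyS
      have : y = x := by simpa [hyS] using hy
      rwa [this]
    · intro e
      rw [e] at hx
      simp at hx


theorem not_mem_Dall {M : Market F W} (hsub : M.SubstAll) (hlad : M.LADAll) {μ μt : Matching F W}
    (hμ : M.Stable μ) (hμt : M.Stable μt) (f : F) (w : W) :
    w ∉ M.Dall μ μt f ↔ M.Surv μ μt f w := by
  have gF := M.goodF hsub hlad f
  have gW := M.goodW hsub hlad w
  have d1 : w ∈ M.D1 μ f ↔ _ := del1 gF (μ.fm f) w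
  have d2 : w ∈ M.D2 μt f ↔ _ := del2 gF (μt.fm f) (hμt.1.1 f) w
  have e1 : f ∈ M.E1 μt w ↔ _ := del1 gW (μt.wm w) f
  have e2 : f ∈ M.E2 μ w ↔ _ := del2 gW (μ.wm w) (hμ.1.2 w) f
  have b1 := hμ.2 f w
  have b2 := hμt.2 f w
  have a2 := fun h => @accW _ _ _ _ M hsub f w (insert f (μ.wm w)) h
  have c1 := μ.consistent f w
  have c2 := μt.consistent f w
  simp only [Blocks] at b1 b2
  simp only [Dall, D3, Surv, Set.mem_union, Set.mem_ofPred_eq, d1, d2, e1, e2]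
  clear d1 d2 e1 e2 gF gW
  grind

theorem not_mem_Eall {M : Market F W} (hsub : M.SubstAll) (hlad : M.LADAll) {μ μt : Matching F W}
    (hμ : M.Stable μ) (hμt : M.Stable μt) (f : F) (w : W) :
    f ∉ M.Eall μ μt w ↔ M.Surv μ μt f w := by
  have gF := M.goodF hsub hlad f
  have gW := M.goodW hsub hlad w
  have d1 : w ∈ M.D1 μ f ↔ _ := del1 gF (μ.fm f) w
  have d2 : w ∈ M.D2 μt f ↔ _ := del2 gF (μt.fm f) (hμt.1.1 f) w
  have e1 : f ∈ M.E1 μt w ↔ _ := del1 gW (μt.wm w) f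
  have e2 : f ∈ M.E2 μ w ↔ _ := del2 gW (μ.wm w) (hμ.1.2 w) f
  have b1 := hμ.2 f w
  have b2 := hμt.2 f w
  have a2 := fun h => @accF _ _ _ _ M hsub f w (insert w (μt.fm f)) h
  have c1 := μ.consistent f w
  have c2 := μt.consistent f w
  simp only [Blocks] at b1 b2
  simp only [Eall, E3, Surv, Set.mem_union, Set.mem_ofPred_eq, d1, d2, e1, e2]
  clear d1 d2 e1 e2 gF gW
  grind

theorem Cfred_eq {M : Market F W} (hsub : M.SubstAll) (hlad : M.LADAll) {μ μt : Matching F W}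
    (hμ : M.Stable μ) (hμt : M.Stable μt) (f : F) (S : Finset W) :
    M.Cfred μ μt f S = M.Cf f (S.filter (M.Surv μ μt f)) := by
  apply bestIn_filter _ (M.injF f)
  intro T
  simp only [RAf, Set.mem_ofPred_eq, not_mem_Dall hsub hlad hμ hμt]

theorem Cwred_eq {M : Market F W} (hsub : M.SubstAll) (hlad : M.LADAll) {μ μt : Matching F W}
    (hμ : M.Stable μ) (hμt : M.Stable μt) (w : W) (S : Finset F) :
    M.Cwred μ μt w S = M.Cw w (S.filter (fun f => M.Surv μ μt f w)) := by
  apply bestIn_filter _ (M.injW w)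
  intro T
  simp only [RAw, Set.mem_ofPred_eq, not_mem_Eall hsub hlad hμ hμt]

theorem polF {M : Market F W} (hsub : M.SubstAll) (hlad : M.LADAll) {μ ν : Matching F W}
    (hν : M.Stable ν) (h : M.geF μ ν) : M.geW ν μ := by
  intro w
  have gW := M.goodW hsub hlad w
  apply gW.eq_of_rej Finset.subset_union_left (hν.1.2 w)
  intro f hf hfν hc
  have hfμ : f ∈ μ.wm w := by
    rw [Finset.mem_union] at hf
    tauto
  refine hν.2 f w ⟨fun hh => hfν ((ν.consistent f w).1 hh), ?_, hc⟩
  have gF := M.goodF hsub hlad f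
  refine gF.subst (μ.fm f ∪ ν.fm f) _ w Finset.subset_union_right ?_
  have := h f
  unfold blairF at this
  rw [this]
  exact (μ.consistent f w).2 hfμ

theorem polW {M : Market F W} (hsub : M.SubstAll) (hlad : M.LADAll) {μ ν : Matching F W}
    (hν : M.Stable ν) (h : M.geW μ ν) : M.geF ν μ := by
  intro f
  have gF := M.goodF hsub hlad f
  apply gF.eq_of_rej Finset.subset_union_left (hν.1.1 f)
  intro w hw hwν hc
  have hwμ : w ∈ μ.fm f := by
    rw [Finset.mem_union] at hw
    tauto
  refine hν.2 f w ⟨hwν, hc, ?_⟩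
  have gW := M.goodW hsub hlad w
  refine gW.subst (μ.wm w ∪ ν.wm w) _ f Finset.subset_union_right ?_
  have := h w
  unfold blairW at this
  rw [this]
  exact (μ.consistent f w).1 hwμ

theorem memF {M : Market F W} (hsub : M.SubstAll) {μ ν : Matching F W}
    (h : M.geF μ ν) {f : F} {w : W} (hw : w ∈ μ.fm f) : w ∈ M.Cf f (insert w (ν.fm f)) := by
  refine hsub.1 f (μ.fm f ∪ ν.fm f) _ w Finset.subset_union_right ?_
  have := h f
  unfold blairF at this
  rwa [this]

theorem memW {M : Market F W} (hsub : M.SubstAll) {μ ν : Matching F W}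
    (h : M.geW μ ν) {f : F} {w : W} (hf : f ∈ μ.wm w) : f ∈ M.Cw w (insert f (ν.wm w)) := by
  refine hsub.2 w (μ.wm w ∪ ν.wm w) _ f Finset.subset_union_right ?_
  have := h w
  unfold blairW at this
  rwa [this]

theorem sum_cards [Fintype W] (μ : Matching F W) (G : Finset F)
    (hG : ∀ w, μ.wm w ⊆ G) : ∑ f ∈ G, (μ.fm f).card = ∑ w, (μ.wm w).card := by
  have := Finset.sum_card_bipartiteAbove_eq_sum_card_bipartiteBelow (s := G)
    (t := (Finset.univ : Finset W)) (fun f w => w ∈ μ.fm f)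
  convert this using 2 with f hf w hw
  · congr 1
    ext w
    simp [Finset.bipartiteAbove]
  · congr 1
    ext f
    simp only [Finset.bipartiteBelow, Finset.mem_filter, μ.consistent]
    exact ⟨fun h => ⟨hG _ h, h⟩, fun h => h.2⟩

theorem rural [Fintype W] {M : Market F W} (hlad : M.LADAll)
    {μ ν : Matching F W} (hμ : M.IR μ) (hν : M.IR ν)
    (h : M.geF μ ν) (h' : M.geW ν μ) :
    (∀ f, (μ.fm f).card = (ν.fm f).card) ∧ ∀ w, (μ.wm w).card = (ν.wm w).card := by
  have l1 : ∀ f, (ν.fm f).card ≤ (μ.fm f).card := by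
    intro f
    have := hlad.1 f (ν.fm f) (μ.fm f ∪ ν.fm f) Finset.subset_union_right
    have e := h f
    unfold blairF at e
    rwa [e, hν.1 f] at this
  have l2 : ∀ w, (μ.wm w).card ≤ (ν.wm w).card := by
    intro w
    have := hlad.2 w (μ.wm w) (ν.wm w ∪ μ.wm w) Finset.subset_union_right
    have e := h' w
    unfold blairW at e
    rwa [e, hμ.2 w] at this
  let G : Finset F := Finset.univ.biUnion fun w => μ.wm w ∪ ν.wm w
  have hG : ∀ w f, f ∈ μ.wm w ∪ ν.wm w → f ∈ G := fun w f hf =>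
    Finset.mem_biUnion.2 ⟨w, Finset.mem_univ _, hf⟩
  have s1 := sum_cards μ G fun w f hf => hG w f (Finset.mem_union_left _ hf)
  have s2 := sum_cards ν G fun w f hf => hG w f (Finset.mem_union_right _ hf)
  have t1 := Finset.sum_le_sum fun f (_ : f ∈ G) => l1 f
  have t2 := Finset.sum_le_sum fun w (_ : w ∈ (Finset.univ : Finset W)) => l2 w
  constructor
  · intro f
    by_cases hf : f ∈ G
    · exact ((Finset.sum_eq_sum_iff_of_le fun f (_ : f ∈ G) => l1 f).1 (by omega) f hf).symm
    · refine le_antisymm ?_ (l1 f)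
      have : μ.fm f = ∅ := by
        rw [Finset.eq_empty_iff_forall_notMem]
        intro w hw
        exact hf (hG w f (Finset.mem_union_left _ ((μ.consistent f w).1 hw)))
      simp [this]
  · intro w
    exact ((Finset.sum_eq_sum_iff_of_le fun w (_ : w ∈ (Finset.univ : Finset W)) => l2 w).1
      (by omega) w (Finset.mem_univ _))

theorem geF_of_Wopt {M : Market F W} (hsub : M.SubstAll) (hlad : M.LADAll)
    {μ μW : Matching F W} (hμ : M.Stable μ) (hWopt : ∀ ν, M.Stable ν → M.geW μW ν) :
    M.geF μ μW := polW hsub hlad hμ (hWopt μ hμ)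

/-- Surviving workers for firm `f`. -/
def AF [Fintype W] (M : Market F W) (μ μt : Matching F W) (f : F) : Finset W :=
  Finset.univ.filter (M.Surv μ μt f)

theorem mem_AF [Fintype W] {M : Market F W} {μ μt : Matching F W} {f : F} {w : W} :
    w ∈ M.AF μ μt f ↔ M.Surv μ μt f w := by simp [AF]

theorem surv_mid {M : Market F W} (hsub : M.SubstAll) {μ ν μW : Matching F W}
    (h1 : M.geF ν μW) (h2 : M.geW ν μ) {f : F} {w : W} (hw : w ∈ ν.fm f) :
    M.Surv μ μW f w :=
  ⟨memF hsub h1 hw, memW hsub h2 ((ν.consistent f w).1 hw)⟩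

theorem geW_refl {M : Market F W} {μ : Matching F W} (h : M.IR μ) : M.geW μ μ := by
  intro w
  unfold blairW
  rw [Finset.union_idempotent, h.2 w]

theorem Cf_AF [Fintype W] {M : Market F W} (hsub : M.SubstAll) (hlad : M.LADAll)
    {μ μW : Matching F W} (hμ : M.Stable μ) (hW : M.geF μ μW) (f : F) :
    M.Cf f (M.AF μ μW f) = μ.fm f := by
  have gF := M.goodF hsub hlad f
  apply gF.eq_of_rej
  · intro w hw
    exact mem_AF.2 (surv_mid hsub hW (geW_refl hμ.1) hw)
  · exact hμ.1.1 f
  · intro w hw hn hc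
    exact hμ.2 f w ⟨hn, hc, (mem_AF.1 hw).2⟩

/-- The successor of a pair `(w, f)` with `w ∈ μ(f) \ ν(f)`. -/
theorem step [Fintype W] {M : Market F W} (hsub : M.SubstAll) (hlad : M.LADAll)
    {μ ν μW : Matching F W} (hμ : M.Stable μ) (hν : M.Stable ν) (hμW : M.Stable μW)
    (hWopt : ∀ ν, M.Stable ν → M.geW μW ν) (hge : M.geF μ ν) (w : W) (f : F)
    (hw : w ∈ μ.fm f) (hwν : w ∉ ν.fm f) :
    ∃ w' f', w' ∈ μ.fm f' ∧ w' ∉ ν.fm f' ∧ w' ∉ μ.fm f ∧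
      M.Surv μ μW f w' ∧
      M.Cf f (M.AF μ μW f \ {w}) = insert w' (μ.fm f \ {w}) ∧
      M.Cw w' (insert f (μ.wm w')) = insert f (μ.wm w' \ {f'}) := by
  have hμW' := geF_of_Wopt hsub hlad hμ hWopt
  have hνW' := geF_of_Wopt hsub hlad hν hWopt
  have hgeW := polF hsub hlad hν hge
  have gF := M.goodF hsub hlad f
  have cA := Cf_AF hsub hlad hμ hμW' f
  have hμA : μ.fm f ⊆ M.AF μ μW f := fun x hx =>
    mem_AF.2 (surv_mid hsub hμW' (geW_refl hμ.1) hx)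
  have hνA : ν.fm f ⊆ M.AF μ μW f \ {w} := by
    intro x hx
    rw [Finset.mem_sdiff, Finset.mem_singleton]
    exact ⟨mem_AF.2 (surv_mid hsub hνW' hgeW hx), fun e => hwν (e ▸ hx)⟩
  obtain ⟨rF, rW⟩ := rural hlad hμ.1 hν.1 hge hgeW
  obtain ⟨-, rW'⟩ := rural hlad hμ.1 hμW.1 hμW' (hWopt μ hμ)
  set D := M.Cf f (M.AF μ μW f \ {w}) with hD
  have hDsub : μ.fm f \ {w} ⊆ D := by
    intro x hx
    have hx' := Finset.mem_sdiff.1 hx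
    refine gF.mono (S := M.AF μ μW f) (by rw [cA]; exact hx'.1) Finset.sdiff_subset ?_
    exact Finset.mem_sdiff.2 ⟨hμA hx'.1, hx'.2⟩
  have hDcard : D.card = (μ.fm f).card := by
    apply le_antisymm
    · rw [← cA]
      exact gF.lad _ _ Finset.sdiff_subset
    · rw [rF f]
      have := gF.lad _ _ hνA
      rwa [hν.1.1 f] at this
  have hc1 : (μ.fm f \ {w}).card + 1 = (μ.fm f).card := by
    rw [Finset.sdiff_singleton_eq_erase]
    exact Finset.card_erase_add_one hw
  have hc2 : (D \ (μ.fm f \ {w})).card = 1 := by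
    rw [Finset.card_sdiff_of_subset hDsub]
    omega
  obtain ⟨w', hw'⟩ := Finset.card_eq_one.1 hc2
  have hDeq : D = insert w' (μ.fm f \ {w}) := by
    rw [← Finset.sdiff_union_of_subset hDsub, hw']
    rfl
  have hw'D : w' ∈ D := by rw [hDeq]; exact Finset.mem_insert_self _ _
  have hw'A := gF.sub _ hw'D
  have hw'n : w' ∉ μ.fm f := by
    intro h
    have h1 : w' ∈ D \ (μ.fm f \ {w}) := by rw [hw']; simp
    have h2 := Finset.mem_sdiff.1 hw'A
    exact (Finset.mem_sdiff.1 h1).2 (Finset.mem_sdiff.2 ⟨h, h2.2⟩)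
  have hS : M.Surv μ μW f w' := mem_AF.1 (Finset.mem_sdiff.1 hw'A).1
  have gW := M.goodW hsub hlad w'
  set E := M.Cw w' (insert f (μ.wm w')) with hE
  have hfE : f ∈ E := hS.2
  have hfn : f ∉ μ.wm w' := fun h => hw'n ((μ.consistent f w').2 h)
  have hEcard : E.card = (μ.wm w').card := by
    apply le_antisymm
    · rw [rW' w']
      have e : M.Cw w' (μW.wm w' ∪ insert f (μ.wm w')) = μW.wm w' := by
        apply gW.eq_of_rej Finset.subset_union_left (hμW.1.2 w')
        intro g hg hgn hgc
        have hsg : M.Surv μ μW g w' := by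
          rw [Finset.mem_union, Finset.mem_insert] at hg
          rcases hg with hg | rfl | hg
          · exact absurd hg hgn
          · exact hS
          · exact surv_mid hsub hμW' (geW_refl hμ.1) ((μ.consistent g w').2 hg)
        exact hμW.2 g w' ⟨fun h => hgn ((μW.consistent g w').1 h), hsg.1, hgc⟩
      rw [← e]
      exact gW.lad _ _ Finset.subset_union_right
    · have := gW.lad _ _ (Finset.subset_insert f (μ.wm w'))
      rwa [hμ.1.2 w'] at this
  have hEsub : E ⊆ insert f (μ.wm w') := gW.sub _
  have hc3 : (insert f (μ.wm w') \ E).card = 1 := by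
    rw [Finset.card_sdiff_of_subset hEsub, Finset.card_insert_of_notMem hfn]
    omega
  obtain ⟨f', hf'⟩ := Finset.card_eq_one.1 hc3
  have hf'm : f' ∈ insert f (μ.wm w') \ E := by rw [hf']; simp
  obtain ⟨hf'1, hf'2⟩ := Finset.mem_sdiff.1 hf'm
  have hff' : f' ≠ f := fun e => hf'2 (e ▸ hfE)
  have hf'μ : f' ∈ μ.wm w' := by simpa [hff'] using hf'1
  have hEeq : E = insert f (μ.wm w' \ {f'}) := by
    rw [← Finset.sdiff_sdiff_eq_self hEsub, hf']
    ext g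
    simp only [Finset.mem_sdiff, Finset.mem_insert, Finset.mem_singleton]
    constructor
    · tauto
    · rintro (rfl | h)
      · exact ⟨Or.inl rfl, fun e => hff' e.symm⟩
      · tauto
  refine ⟨w', f', (μ.consistent _ _).2 hf'μ, ?_, hw'n, hS, hDeq, hEeq⟩
  intro hf'ν
  rw [ν.consistent] at hf'ν
  have e : M.Cw w' (ν.wm w' ∪ insert f (μ.wm w')) = ν.wm w' := by
    apply gW.eq_of_rej Finset.subset_union_left (hν.1.2 w')
    intro g hg hgn hgc
    refine hν.2 g w' ⟨fun h => hgn ((ν.consistent g w').1 h), ?_, hgc⟩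
    rw [Finset.mem_union, Finset.mem_insert] at hg
    rcases hg with hg | rfl | hg
    · exact absurd hg hgn
    · exact gF.subst _ _ _ hνA hw'D
    · exact memF hsub hge ((μ.consistent g w').2 hg)
  exact hf'2 (gW.mono (S := ν.wm w' ∪ insert f (μ.wm w')) (by rw [e]; exact hf'ν)
    Finset.subset_union_right hf'1)

/-- Existence of a cycle through pairs in `μ \ ν`, with pairwise distinct pairs. -/
theorem exists_orbit [Fintype W] {M : Market F W} (hsub : M.SubstAll) (hlad : M.LADAll)
    {μ ν μW : Matching F W} (hμ : M.Stable μ) (hν : M.Stable ν) (hμW : M.Stable μW)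
    (hWopt : ∀ ν, M.Stable ν → M.geW μW ν) (hge : M.geF μ ν) (hne : ∃ f w, w ∈ μ.fm f ∧ w ∉ ν.fm f) :
    ∃ (r : ℕ) (w : ℕ → W) (f : ℕ → F), 0 < r ∧ (∀ i, w (i + r) = w i) ∧ (∀ i, f (i + r) = f i) ∧
      (∀ i < r, ∀ j < r, w i = w j → f i = f j → i = j) ∧
      (∀ i < r, ∀ j < r, w (i + 1) = w (j + 1) → f (i + 1) = f (j + 1) → i = j) ∧
      ∀ i, w i ∈ μ.fm (f i) ∧ w i ∉ ν.fm (f i) ∧ w (i + 1) ∉ μ.fm (f i) ∧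
        M.Surv μ μW (f i) (w (i + 1)) ∧
        M.Cf (f i) (M.AF μ μW (f i) \ {w i}) = insert (w (i + 1)) (μ.fm (f i) \ {w i}) ∧
        M.Cw (w (i + 1)) (insert (f i) (μ.wm (w (i + 1)))) =
          insert (f i) (μ.wm (w (i + 1)) \ {f (i + 1)}) := by
  let X := {p : W × F // p.1 ∈ μ.fm p.2 ∧ p.1 ∉ ν.fm p.2}
  have hfin : Finite X := by
    let G : Finset F := Finset.univ.biUnion fun w => μ.wm w
    have : Set.Finite {p : W × F | p.1 ∈ μ.fm p.2 ∧ p.1 ∉ ν.fm p.2} := by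
      apply Set.Finite.subset (Finset.finite_toSet ((Finset.univ : Finset W) ×ˢ G))
      rintro ⟨a, b⟩ ⟨h1, -⟩
      simp only [Finset.coe_product, Set.mem_prod, Finset.mem_coe, Finset.mem_univ, true_and, G,
        Finset.mem_biUnion]
      exact ⟨a, (μ.consistent b a).1 h1⟩
    exact this.to_subtype
  have hstep : ∀ p : X, ∃ q : X, q.1.1 ∉ μ.fm p.1.2 ∧ M.Surv μ μW p.1.2 q.1.1 ∧
      M.Cf p.1.2 (M.AF μ μW p.1.2 \ {p.1.1}) = insert q.1.1 (μ.fm p.1.2 \ {p.1.1}) ∧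
      M.Cw q.1.1 (insert p.1.2 (μ.wm q.1.1)) = insert p.1.2 (μ.wm q.1.1 \ {q.1.2}) := by
    rintro ⟨⟨a, b⟩, h1, h2⟩
    obtain ⟨a', b', k1, k2, k3⟩ := step hsub hlad hμ hν hμW hWopt hge a b h1 h2
    exact ⟨⟨⟨a', b'⟩, k1, k2⟩, k3⟩
  choose T hT using hstep
  obtain ⟨f0, w0, hf0⟩ := hne
  let x0 : X := ⟨(w0, f0), hf0⟩
  have hper : ∃ y : X, y ∈ Function.periodicPts T := by
    obtain ⟨i, j, hij, he⟩ := Finite.exists_ne_map_eq_of_infinite (fun n : ℕ => T^[n] x0)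
    wlog hlt : i < j generalizing i j
    · exact this j i hij.symm he.symm (by omega)
    refine ⟨T^[i] x0, Function.mk_mem_periodicPts (n := j - i) (by omega) ?_⟩
    change T^[j - i] (T^[i] x0) = T^[i] x0
    rw [← Function.iterate_add_apply, Nat.sub_add_cancel hlt.le]
    exact he.symm
  obtain ⟨y, hy⟩ := hper
  have hinj := Function.iterate_injOn_Iio_minimalPeriod (f := T) (x := y)
  have hpos := Function.minimalPeriod_pos_of_mem_periodicPts hy
  have hmod : ∀ n, T^[n + Function.minimalPeriod T y] y = T^[n] y := fun n => by
    rw [Function.iterate_add_minimalPeriod_eq]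
  have key : ∀ i < Function.minimalPeriod T y, ∀ j < Function.minimalPeriod T y,
      T^[i] y = T^[j] y → i = j := fun i hi j hj h => hinj hi hj h
  refine ⟨Function.minimalPeriod T y, fun i => (T^[i] y).1.1, fun i => (T^[i] y).1.2, hpos,
    fun i => by simp only [hmod], fun i => by simp only [hmod], ?_, ?_, ?_⟩
  · intro i hi j hj h1 h2
    exact key i hi j hj (Subtype.ext (Prod.ext h1 h2))
  · intro i hi j hj h1 h2
    have h : T^[i + 1] y = T^[j + 1] y := Subtype.ext (Prod.ext h1 h2)
    apply key i hi j hj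
    rw [← hmod i, ← hmod j]
    obtain ⟨m, hm⟩ : ∃ m, Function.minimalPeriod T y = m + 1 := ⟨_, (Nat.succ_pred_eq_of_pos hpos).symm⟩
    have e : ∀ i, i + Function.minimalPeriod T y = m + (i + 1) := fun i => by omega
    rw [e, e, Function.iterate_add_apply, Function.iterate_add_apply T m (j + 1), h]
  · intro i
    simp only [Function.iterate_succ_apply']
    exact ⟨(T^[i] y).2.1, (T^[i] y).2.2, hT _⟩

theorem advance [Fintype W] {M : Market F W} (hsub : M.SubstAll) (hlad : M.LADAll)
    {μ ν μW : Matching F W} (hμ : M.Stable μ) (hν : M.Stable ν) (hμW : M.Stable μW)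
    (hWopt : ∀ ν, M.Stable ν → M.geW μW ν) (hge : M.geF μ ν)
    (hne : ∃ f w, w ∈ μ.fm f ∧ w ∉ ν.fm f) :
    ∃ μ' : Matching F W, M.Stable μ' ∧ M.geF μ' ν ∧ M.IsCyclicMatching μ μW μ' ∧
      ∑ w, M.uW w (μ.wm w) < ∑ w, M.uW w (μ'.wm w) := by
  obtain ⟨r, w, f, hr, pw, pf, inj1, inj2, hcyc⟩ :=
    exists_orbit hsub hlad hμ hν hμW hWopt hge hne
  have hμW' := geF_of_Wopt hsub hlad hμ hWopt
  have hνW' := geF_of_Wopt hsub hlad hν hWopt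
  have hgeW := polF hsub hlad hν hge
  have gF := M.goodF hsub hlad
  have gW := M.goodW hsub hlad
  have hi1 : ∀ i, w i ∈ μ.fm (f i) := fun i => (hcyc i).1
  have hi2 : ∀ i, w i ∉ ν.fm (f i) := fun i => (hcyc i).2.1
  have hi3 : ∀ i, w (i + 1) ∉ μ.fm (f i) := fun i => (hcyc i).2.2.1
  have hi4 : ∀ i, M.Surv μ μW (f i) (w (i + 1)) := fun i => (hcyc i).2.2.2.1
  have hi5 := fun i => (hcyc i).2.2.2.2.1
  have hi6 := fun i => (hcyc i).2.2.2.2.2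
  have hμA : ∀ g, μ.fm g ⊆ M.AF μ μW g := fun g x hx =>
    mem_AF.2 (surv_mid hsub hμW' (geW_refl hμ.1) hx)
  have hνA : ∀ g, ν.fm g ⊆ M.AF μ μW g := fun g x hx =>
    mem_AF.2 (surv_mid hsub hνW' hgeW hx)
  have hWA : ∀ g, μW.fm g ⊆ M.AF μ μW g := fun g x hx =>
    mem_AF.2 (surv_mid hsub (geF_of_Wopt hsub hlad hμW hWopt) (hWopt μ hμ) hx)
  have hi7 : ∀ i, w i ∉ μW.fm (f i) := by
    intro i h
    refine hν.2 (f i) (w i) ⟨hi2 i, memF hsub hge (hi1 i), ?_⟩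
    exact memW hsub (hWopt ν hν) ((μW.consistent _ _).1 h)
  have hdrop : ∀ i, f (i + 1) ∉ M.Cw (w (i + 1)) (insert (f i) (μ.wm (w (i + 1)))) := by
    intro i h
    rw [hi6 i] at h
    simp only [Finset.mem_insert, Finset.mem_sdiff, Finset.mem_singleton, not_true_eq_false,
      and_false, or_false] at h
    exact hi3 i (h ▸ hi1 (i + 1))
  have hmodw : ∀ i, w (i % r) = w i := fun i => Function.Periodic.map_mod_nat (a := r) pw i
  have hmodf : ∀ i, f (i % r) = f i := fun i => Function.Periodic.map_mod_nat (a := r) pf i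
  have hmodw' : ∀ i, w (i % r + 1) = w (i + 1) := fun i =>
    Function.Periodic.map_mod_nat (f := fun i => w (i + 1)) (a := r)
      (fun i => by change w (i + r + 1) = w (i + 1); rw [add_right_comm, pw]) i
  have hpred : ∀ i, ∃ j, w (j + 1) = w i ∧ f (j + 1) = f i := by
    intro i
    refine ⟨i + (r - 1), ?_, ?_⟩
    · rw [add_assoc, Nat.sub_add_cancel hr, pw]
    · rw [add_assoc, Nat.sub_add_cancel hr, pf]
  have hmem : ∀ g x, x ∈ cyclicFm μ r w f g ↔
      (x ∈ μ.fm g ∧ ∀ i, f i = g → w i ≠ x) ∨ ∃ i, f i = g ∧ w (i + 1) = x := by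
    intro g x
    have key1 : (∀ i, f i = g → w i ≠ x) ↔ ∀ i < r, f i = g → w i ≠ x := by
      constructor
      · exact fun h i _ => h i
      · intro h i h1 h2
        exact h (i % r) (Nat.mod_lt _ hr) (by rw [hmodf, h1]) (by rw [hmodw, h2])
    have key2 : (∃ i, f i = g ∧ w (i + 1) = x) ↔ ∃ i < r, f i = g ∧ w (i + 1) = x := by
      constructor
      · rintro ⟨i, h1, h2⟩
        exact ⟨i % r, Nat.mod_lt _ hr, by rw [hmodf, h1], by rw [hmodw', h2]⟩
      · rintro ⟨i, _, h⟩
        exact ⟨i, h⟩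
    rw [key1, key2]
    unfold cyclicFm
    split_ifs with hg
    · simp only [Finset.mem_union, Finset.mem_sdiff, Finset.mem_image, Finset.mem_filter,
        Finset.mem_range, not_exists, not_and, and_assoc, ne_eq]
    · constructor
      · intro hx
        exact Or.inl ⟨hx, fun i hi h => absurd ⟨i, Finset.mem_range.2 hi, h⟩ hg⟩
      · rintro (h | ⟨i, hi, h, -⟩)
        · exact h.1
        · exact absurd ⟨i, Finset.mem_range.2 hi, h⟩ hg
  let μ' : Matching F W :=
    { fm := cyclicFm μ r w f
      wm := fun x => (μ.wm x ∪ (Finset.range r).image f).filter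
        (fun g => x ∈ cyclicFm μ r w f g)
      consistent := by
        intro g x
        rw [Finset.mem_filter]
        refine ⟨fun h => ⟨?_, h⟩, fun h => h.2⟩
        rw [hmem] at h
        rw [Finset.mem_union, Finset.mem_image]
        rcases h with h | ⟨i, h, -⟩
        · exact Or.inl ((μ.consistent _ _).1 h.1)
        · exact Or.inr ⟨i % r, Finset.mem_range.2 (Nat.mod_lt _ hr), by rw [hmodf, h]⟩ }
  have hfm : ∀ g x, x ∈ μ'.fm g ↔
      (x ∈ μ.fm g ∧ ∀ i, f i = g → w i ≠ x) ∨ ∃ i, f i = g ∧ w (i + 1) = x := hmem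
  have hwm : ∀ g x, g ∈ μ'.wm x ↔
      (g ∈ μ.wm x ∧ ∀ i, f i = g → w i ≠ x) ∨ ∃ i, f i = g ∧ w (i + 1) = x := by
    intro g x
    rw [← μ'.consistent, hfm, μ.consistent]
  clear_value μ'
  let I : F → Finset ℕ := fun g => (Finset.range r).filter (fun i => f i = g)
  let R : F → Finset W := fun g => (I g).image w
  have hI : ∀ g i, i ∈ I g ↔ i < r ∧ f i = g := fun g i => by
    simp only [I, Finset.mem_filter, Finset.mem_range]
  have hR : ∀ g x, x ∈ R g ↔ ∃ i, f i = g ∧ w i = x := by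
    intro g x
    simp only [R, Finset.mem_image, hI]
    constructor
    · rintro ⟨i, ⟨_, h1⟩, h2⟩
      exact ⟨i, h1, h2⟩
    · rintro ⟨i, h1, h2⟩
      exact ⟨i % r, ⟨Nat.mod_lt _ hr, by rw [hmodf, h1]⟩, by rw [hmodw, h2]⟩
  have hfirm : ∀ g, M.Cf g (M.AF μ μW g \ R g) = μ'.fm g := by
    intro g
    symm
    apply Finset.eq_of_subset_of_card_le
    · intro x hx
      rcases (hfm g x).1 hx with ⟨h1, h2⟩ | ⟨i, rfl, rfl⟩
      · refine (gF g).mono (S := M.AF μ μW g) ?_ Finset.sdiff_subset ?_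
        · rwa [Cf_AF hsub hlad hμ hμW']
        · refine Finset.mem_sdiff.2 ⟨hμA g h1, fun h => ?_⟩
          obtain ⟨i, h3, h4⟩ := (hR g x).1 h
          exact h2 i h3 h4
      · refine (gF (f i)).mono (S := M.AF μ μW (f i) \ {w i}) ?_ ?_ ?_
        · rw [hi5]
          exact Finset.mem_insert_self _ _
        · intro x hx
          rw [Finset.mem_sdiff] at hx ⊢
          refine ⟨hx.1, fun h => hx.2 ((hR _ _).2 ⟨i, rfl, ?_⟩)⟩
          exact (Finset.mem_singleton.1 h).symm
        · refine Finset.mem_sdiff.2 ⟨mem_AF.2 (hi4 i), fun h => ?_⟩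
          obtain ⟨j, h3, h4⟩ := (hR _ _).1 h
          apply hi3 i
          rw [← h3, ← h4]
          exact hi1 j
    · have c1 : (M.Cf g (M.AF μ μW g \ R g)).card ≤ (μ.fm g).card := by
        rw [← Cf_AF hsub hlad hμ hμW' g]
        exact (gF g).lad _ _ Finset.sdiff_subset
      have hRsub : R g ⊆ μ.fm g := by
        intro x hx
        obtain ⟨i, rfl, rfl⟩ := (hR g x).1 hx
        exact hi1 i
      have hRc : (R g).card ≤ (I g).card := Finset.card_image_le
      let J : Finset W := (I g).image (fun i => w (i + 1))
      have hJ : J.card = (I g).card := by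
        apply Finset.card_image_of_injOn
        intro i hi j hj h
        have hi' := (hI g i).1 hi
        have hj' := (hI g j).1 hj
        have h : w (i + 1) = w (j + 1) := h
        refine inj2 i hi'.1 j hj'.1 h ?_
        have hd := hdrop i
        rw [h, hi'.2, ← hj'.2, hi6 j] at hd
        have hm := (μ.consistent _ _).1 (hi1 (i + 1))
        rw [h] at hm
        by_contra hne
        exact hd (Finset.mem_insert_of_mem (Finset.mem_sdiff.2 ⟨hm, by simpa using hne⟩))
      have hdisj : Disjoint (μ.fm g \ R g) J := by
        rw [Finset.disjoint_left]
        intro x hx hx'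
        obtain ⟨i, hi, rfl⟩ := Finset.mem_image.1 hx'
        have := (hI g i).1 hi
        apply hi3 i
        rw [this.2]
        exact (Finset.mem_sdiff.1 hx).1
      have hsubs : (μ.fm g \ R g) ∪ J ⊆ μ'.fm g := by
        intro x hx
        rw [hfm]
        rcases Finset.mem_union.1 hx with hx | hx
        · obtain ⟨h1, h2⟩ := Finset.mem_sdiff.1 hx
          exact Or.inl ⟨h1, fun i h3 h4 => h2 ((hR _ _).2 ⟨i, h3, h4⟩)⟩
        · obtain ⟨i, hi, rfl⟩ := Finset.mem_image.1 hx
          exact Or.inr ⟨i, ((hI g i).1 hi).2, rfl⟩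
      have c2 := Finset.card_le_card hsubs
      rw [Finset.card_union_of_disjoint hdisj, Finset.card_sdiff_of_subset hRsub, hJ] at c2
      have c3 := Finset.card_le_card hRsub
      omega
  let K : W → Finset ℕ := fun x => (Finset.range r).filter (fun i => w (i + 1) = x)
  have hK : ∀ x i, i ∈ K x ↔ i < r ∧ w (i + 1) = x := fun x i => by
    simp only [K, Finset.mem_filter, Finset.mem_range]
  let Q : W → Finset F := fun x => (K x).image f
  have hQ : ∀ x g, g ∈ Q x ↔ ∃ i, f i = g ∧ w (i + 1) = x := by
    intro x g
    simp only [Q, Finset.mem_image, hK]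
    constructor
    · rintro ⟨i, ⟨_, h1⟩, h2⟩
      exact ⟨i, h2, h1⟩
    · rintro ⟨i, h1, h2⟩
      exact ⟨i % r, ⟨Nat.mod_lt _ hr, by rw [hmodw', h2]⟩, by rw [hmodf, h1]⟩
  have hout : ∀ i S, μ.wm (w i) ∪ Q (w i) ⊆ S → f i ∉ M.Cw (w i) S := by
    intro i S hS h
    obtain ⟨j, h1, h2⟩ := hpred i
    apply hdrop j
    rw [h1, h2]
    refine (gW (w i)).mono h ?_ ?_
    · refine Finset.Subset.trans ?_ hS
      intro y hy
      rcases Finset.mem_insert.1 hy with rfl | hy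
      · exact Finset.mem_union_right _ ((hQ _ _).2 ⟨j, rfl, h1⟩)
      · exact Finset.mem_union_left _ hy
    · exact Finset.mem_insert_of_mem ((μ.consistent _ _).1 (hi1 i))
  have hwork : ∀ x, M.Cw x (μ.wm x ∪ Q x) = μ'.wm x := by
    intro x
    apply Finset.eq_of_subset_of_card_le
    · intro g hg
      rw [hwm]
      rcases Finset.mem_union.1 ((gW x).sub _ hg) with h | h
      · refine Or.inl ⟨h, ?_⟩
        rintro i rfl rfl
        exact hout i _ subset_rfl hg
      · exact Or.inr ((hQ _ _).1 h)
    · have c1 := (gW x).lad _ _ (Finset.subset_union_left (s₁ := μ.wm x) (s₂ := Q x))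
      rw [hμ.1.2 x] at c1
      let L : Finset F := (K x).image (fun i => f (i + 1))
      have hL : L.card = (K x).card := by
        apply Finset.card_image_of_injOn
        intro i hi j hj h
        have hi' := (hK x i).1 hi
        have hj' := (hK x j).1 hj
        exact inj2 i hi'.1 j hj'.1 (hi'.2.trans hj'.2.symm) h
      have hLsub : L ⊆ μ.wm x := by
        intro g hg
        obtain ⟨i, hi, rfl⟩ := Finset.mem_image.1 hg
        have := (hK x i).1 hi
        rw [← this.2]
        exact (μ.consistent _ _).1 (hi1 (i + 1))
      have hsubs : μ'.wm x ⊆ (μ.wm x \ L) ∪ Q x := by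
        intro g hg
        rw [hwm] at hg
        rw [Finset.mem_union, hQ]
        rcases hg with ⟨h1, h2⟩ | h
        · refine Or.inl (Finset.mem_sdiff.2 ⟨h1, fun h => ?_⟩)
          obtain ⟨i, hi, e⟩ := Finset.mem_image.1 h
          exact h2 (i + 1) e ((hK x i).1 hi).2
        · exact Or.inr h
      have c2 := (Finset.card_le_card hsubs).trans (Finset.card_union_le _ _)
      rw [Finset.card_sdiff_of_subset hLsub, hL] at c2
      have c3 := Finset.card_le_card hLsub
      have c4 : (Q x).card ≤ (K x).card := Finset.card_image_le
      omega
  have hgeFgen : ∀ κ : Matching F W, (∀ g, κ.fm g ⊆ M.AF μ μW g) → (∀ i, w i ∉ κ.fm (f i)) →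
      M.geF μ' κ := by
    intro κ h1 h2 g
    unfold blairF
    have hs : κ.fm g ⊆ M.AF μ μW g \ R g := by
      intro x hx
      refine Finset.mem_sdiff.2 ⟨h1 g hx, fun h => ?_⟩
      obtain ⟨i, rfl, rfl⟩ := (hR _ _).1 h
      exact h2 i hx
    conv_rhs => rw [← hfirm g]
    apply (gF g).cons
    · rw [hfirm g]
      exact Finset.subset_union_left
    · refine Finset.union_subset ?_ hs
      rw [← hfirm g]
      exact (gF g).sub _
  refine ⟨μ', ⟨⟨?_, ?_⟩, ?_⟩, hgeFgen ν hνA hi2, ?_, ?_⟩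
  · intro g
    rw [← hfirm g]
    exact (gF g).idem _
  · intro x
    rw [← hwork x]
    exact (gW x).idem _
  · rintro g x ⟨b1, b2, b3⟩
    rw [← hwork x, (gW x).pi] at b3
    have s2 : g ∈ M.Cw x (insert g (μ.wm x)) :=
      (gW x).subst _ (μ.wm x) g
        (Finset.subset_union_left.trans (Finset.subset_insert _ _)) b3
    rw [← hfirm g, (gF g).pi] at b2
    have s1 : x ∈ M.Cf g (insert x (μW.fm g)) := by
      refine (gF g).subst _ (μW.fm g) x ?_ b2
      refine Finset.Subset.trans ?_ (Finset.subset_insert _ _)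
      intro y hy
      refine Finset.mem_sdiff.2 ⟨hWA g hy, fun h => ?_⟩
      obtain ⟨i, rfl, rfl⟩ := (hR _ _).1 h
      exact hi7 i hy
    have hA : x ∈ M.AF μ μW g := mem_AF.2 ⟨s1, s2⟩
    by_cases hx : x ∈ R g
    · obtain ⟨i, rfl, rfl⟩ := (hR _ _).1 hx
      exact hout i _ (Finset.subset_insert _ _) b3
    · rw [Finset.insert_eq_of_mem (Finset.mem_sdiff.2 ⟨hA, hx⟩), hfirm] at b2
      exact b1 b2
  · refine ⟨r, w, f, ⟨hr, pw, pf, fun i => ⟨⟨hi1 i, hi7 i⟩, ?_, ?_⟩⟩, ?_⟩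
    · rw [Cfred_eq hsub hlad hμ hμW, ← hi5 i]
      congr 1
      ext x
      simp only [Finset.mem_filter, Finset.mem_sdiff, Finset.mem_univ, true_and, mem_AF]
      exact and_comm
    · rw [Cwred_eq hsub hlad hμ hμW, ← hi6 i]
      congr 1
      ext g
      simp only [Finset.mem_filter, Finset.mem_union, Finset.mem_singleton, Finset.mem_insert]
      constructor
      · rintro ⟨h1 | h1, -⟩
        · exact Or.inr h1
        · exact Or.inl h1
      · rintro (rfl | h)
        · exact ⟨Or.inr rfl, hi4 i⟩
        · exact ⟨Or.inl h, surv_mid hsub hμW' (geW_refl hμ.1) ((μ.consistent _ _).2 h)⟩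
    · intro g
      ext x
      rw [hfm, hmem]
  · have hle : ∀ x, M.uW x (μ.wm x) ≤ M.uW x (μ'.wm x) := by
      intro x
      rw [← hwork x]
      obtain ⟨-, -, c⟩ := bestIn_spec (M.uW x) {T | M.uW x ∅ < M.uW x T} (μ.wm x ∪ Q x)
      refine c _ Finset.subset_union_left ?_
      have := (bestIn_spec (M.uW x) {T | M.uW x ∅ < M.uW x T} (μ.wm x)).2.1
      have e : bestIn (M.uW x) {T | M.uW x ∅ < M.uW x T} (μ.wm x) = μ.wm x := hμ.1.2 x
      rwa [e] at this
    apply Finset.sum_lt_sum (fun x _ => hle x)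
    refine ⟨w (0 + 1), Finset.mem_univ _, lt_of_le_of_ne (hle _) fun e => ?_⟩
    have e' := M.injW _ e
    have h1 : f 0 ∈ μ'.wm (w (0 + 1)) := (hwm _ _).2 (Or.inr ⟨0, rfl, rfl⟩)
    rw [← e', ← μ.consistent] at h1
    exact hi3 0 h1

theorem reach [Fintype W] {M : Market F W} (hsub : M.SubstAll) (hlad : M.LADAll)
    {ν μW : Matching F W} (hν : M.Stable ν) (hμW : M.Stable μW)
    (hWopt : ∀ ν, M.Stable ν → M.geW μW ν) (n : ℕ) : ∀ μ : Matching F W, M.Stable μ →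
    M.geF μ ν → ∑ w, M.uW w (ν.wm w) < ∑ w, M.uW w (μ.wm w) + n →
      ∃ (k : ℕ) (seq : ℕ → Matching F W), seq 0 = μ ∧ seq k = ν ∧
        (∀ i, i ≤ k → M.Stable (seq i)) ∧
        (∀ i, i < k → M.IsCyclicMatching (seq i) μW (seq (i + 1))) := by
  have hle : ∀ μ : Matching F W, M.Stable μ → M.geF μ ν →
      ∑ w, M.uW w (μ.wm w) ≤ ∑ w, M.uW w (ν.wm w) := by
    intro μ hμ hge
    apply Finset.sum_le_sum
    intro x _
    have h1 := polF hsub hlad hν hge x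
    obtain ⟨-, -, c⟩ := bestIn_spec (M.uW x) {T | M.uW x ∅ < M.uW x T} (ν.wm x ∪ μ.wm x)
    have e1 : bestIn (M.uW x) {T | M.uW x ∅ < M.uW x T} (ν.wm x ∪ μ.wm x) = ν.wm x := h1
    rw [e1] at c
    refine c _ Finset.subset_union_right ?_
    have := (bestIn_spec (M.uW x) {T | M.uW x ∅ < M.uW x T} (μ.wm x)).2.1
    have e : bestIn (M.uW x) {T | M.uW x ∅ < M.uW x T} (μ.wm x) = μ.wm x := hμ.1.2 x
    rwa [e] at this
  induction n with
  | zero =>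
    intro μ hμ hge hlt
    have := hle μ hμ hge
    omega
  | succ n ih =>
    intro μ hμ hge hlt
    by_cases hne : ∃ f w, w ∈ μ.fm f ∧ w ∉ ν.fm f
    · obtain ⟨μ', h1, h2, h3, h4⟩ := advance hsub hlad hμ hν hμW hWopt hge hne
      obtain ⟨k, seq, s0, sk, s1, s2⟩ := ih μ' h1 h2 (by omega)
      refine ⟨k + 1, fun i => Nat.casesOn i μ seq, rfl, sk, ?_, ?_⟩
      · intro i hi
        cases i with
        | zero => exact hμ
        | succ i => exact s1 i (by omega)
      · intro i hi
        cases i with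
        | zero =>
          change M.IsCyclicMatching μ μW (seq 0)
          rw [s0]
          exact h3
        | succ i => exact s2 i (by omega)
    · have hfm : μ.fm = ν.fm := by
        funext g
        have hs : μ.fm g ⊆ ν.fm g := by
          intro x hx
          by_contra h
          exact hne ⟨g, x, hx, h⟩
        have := hge g
        unfold blairF at this
        rw [Finset.union_eq_right.2 hs, hν.1.1 g] at this
        exact this.symm
      have hwm : μ.wm = ν.wm := by
        funext x
        ext g
        rw [← μ.consistent, ← ν.consistent, hfm]
      have : μ = ν := by
        cases μ
        cases ν
        simp only at hfm hwm
        subst hfm hwm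
        rfl
      subst this
      exact ⟨0, fun _ => μ, rfl, rfl, fun _ _ => hμ, fun i hi => absurd hi (by omega)⟩

end Market

/-- Theorem 2. With substitutable preferences satisfying the law of
aggregate demand, a matching `μ` is stable under `P` if and only if it is reachable from
the firm-optimal stable matching `μ_F` by a finite sequence `μ_0 = μ_F, μ_1, …, μ_k = μ`
of stable matchings in which each `μ_{i+1}` is a cyclic matching under the reduced
profile `P^{μ_i} = P^{μ_i, μ_W}`. In particular, `μ_F` together with all matchings
reachable from `μ_F` by finitely many cyclic-matching steps is the full set `S(P)`. -/
theorem algorithm_computes_all_stable {F W : Type*} [DecidableEq F] [DecidableEq W]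
    [Fintype W] (M : Market F W) (hsub : M.SubstAll) (hlad : M.LADAll)
    (μF μW : Matching F W)
    (hμF : M.Stable μF) (hFopt : ∀ ν, M.Stable ν → M.geF μF ν)
    (hμW : M.Stable μW) (hWopt : ∀ ν, M.Stable ν → M.geW μW ν) :
    ∀ ν : Matching F W, M.Stable ν ↔
      ∃ (k : ℕ) (seq : ℕ → Matching F W), seq 0 = μF ∧ seq k = ν ∧
        (∀ i, i ≤ k → M.Stable (seq i)) ∧
        (∀ i, i < k → M.IsCyclicMatching (seq i) μW (seq (i + 1))) := by
  intro ν
  constructor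
  · intro hν
    exact Market.reach hsub hlad hν hμW hWopt (∑ w, M.uW w (ν.wm w) + 1) μF hμF (hFopt ν hν)
      (by omega)
  · rintro ⟨k, seq, -, hk, hs, -⟩
    rw [← hk]
    exact hs k le_rfl
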